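/- Let (A, L) be a random financial network and b > 0. Then the infimum defining the systemic risk measure is attained: there exists Y* ∈ 𝒞 with Σ_{i=1}^N Y*_i = ρ_b(A, L) ℙ-a.s. and η(Λ(A+Y*, L)) ≤ b. -/

import Mathlib

open MeasureTheory

/-- Total liability vector: `ℓ̄_i = ∑_j ℓ_{ij}`. -/
noncomputable def lbar {N : ℕ} (ℓ : Fin N → Fin N → ℝ) : Fin N → ℝ := fun i => ∑ j, ℓ i j

/-- Relative liability matrix: `π_{ij} = ℓ_{ij}/ℓ̄_i` if `ℓ̄_i > 0`, else `0`. -/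
noncomputable def relPi {N : ℕ} (ℓ : Fin N → Fin N → ℝ) : Fin N → Fin N → ℝ :=
  fun i j => if 0 < lbar ℓ i then ℓ i j / lbar ℓ i else 0

/-- The Eisenberg–Noe clearing map `Φ(p, a, π, ℓ̄) = (πᵀp + a) ∧ ℓ̄`. -/
noncomputable def Phi {N : ℕ} (π : Fin N → Fin N → ℝ) (a lb p : Fin N → ℝ) : Fin N → ℝ :=
  fun i => min ((∑ j, π j i * p j) + a i) (lb i)

/-- The clearing vector `CV(a, ℓ)`: the (for `a ∈ ℝ^N_{++}` unique) nonnegative fixed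
point of the clearing map associated with the liability matrix `ℓ`. -/
noncomputable def clearingVec {N : ℕ} (a : Fin N → ℝ) (ℓ : Fin N → Fin N → ℝ) : Fin N → ℝ :=
  Classical.epsilon fun p => (∀ i, 0 ≤ p i) ∧ Phi (relPi ℓ) a (lbar ℓ) p = p

/-- The Eisenberg–Noe aggregation function `Λ(a, ℓ) = ∑_i (ℓ̄_i − CV_i(a, ℓ))`. -/
noncomputable def aggLoss {N : ℕ} (a : Fin N → ℝ) (ℓ : Fin N → Fin N → ℝ) : ℝ :=
  ∑ i, (lbar ℓ i - clearingVec a ℓ i)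

/-- The feasible total bailout-capital levels: constants `c` such that some admissible
random allocation `Y ∈ 𝒞` with `∑ᵢ Yᵢ = c` a.s. makes the system acceptable. -/
noncomputable def feas {Ω : Type*} [MeasurableSpace Ω] (P : Measure Ω) {N : ℕ}
    (η : (Ω → ℝ) → ℝ) (A : Ω → Fin N → ℝ) (L : Ω → Fin N → Fin N → ℝ) (b : ℝ) : Set ℝ :=
  {c : ℝ | ∃ Y : Ω → Fin N → ℝ, Measurable Y ∧ (∀ ω i, 0 ≤ Y ω i) ∧
    (∀ᵐ ω ∂P, ∑ i, Y ω i = c) ∧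
    η (fun ω => aggLoss (fun i => A ω i + Y ω i) (L ω)) ≤ b}

/-- The systemic risk measure `ρ_b(A, L)`. -/
noncomputable def sysRisk {Ω : Type*} [MeasurableSpace Ω] (P : Measure Ω) {N : ℕ}
    (η : (Ω → ℝ) → ℝ) (A : Ω → Fin N → ℝ) (L : Ω → Fin N → Fin N → ℝ) (b : ℝ) : ℝ :=
  sInf (feas P η A L b)

open Filter Topology

/-- Vectors near the infimum of the norm in a decreasing sequence of bounded midpoint-convex sets
form a convergent sequence. -/
theorem exists_seq_mem_tendsto_of_antitone_midpoint {H : Type*} [NormedAddCommGroup H]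
    [InnerProductSpace ℝ H] [CompleteSpace H] (C : ℕ → Set H) (hanti : Antitone C)
    (hne : ∀ n, (C n).Nonempty)
    (hmid : ∀ n, ∀ x ∈ C n, ∀ y ∈ C n, (1 / 2 : ℝ) • (x + y) ∈ C n)
    (R : ℝ) (hR : ∀ x ∈ C 0, ‖x‖ ≤ R) :
    ∃ x : ℕ → H, (∀ n, x n ∈ C n) ∧ ∃ l, Tendsto x atTop (𝓝 l) := by
  set S : ℕ → Set ℝ := fun n => (fun x : H => ‖x‖ ^ 2) '' C n with hS
  set d : ℕ → ℝ := fun n => sInf (S n) with hd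
  have hSne : ∀ n, (S n).Nonempty := fun n => (hne n).image _
  have hSbdd : ∀ n, BddBelow (S n) := by
    intro n
    refine ⟨0, ?_⟩
    rintro _ ⟨x, -, rfl⟩
    positivity
  have hd_le : ∀ n, ∀ x ∈ C n, d n ≤ ‖x‖ ^ 2 := fun n x hx => csInf_le (hSbdd n) ⟨x, hx, rfl⟩
  have hmono : Monotone d := fun m n hmn =>
    csInf_le_csInf (hSbdd m) (hSne n) (Set.image_mono (hanti hmn))
  have hbdd : BddAbove (Set.range d) := by
    refine ⟨R ^ 2, ?_⟩
    rintro _ ⟨n, rfl⟩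
    obtain ⟨x, hx⟩ := hne n
    exact (hd_le n x hx).trans (pow_le_pow_left₀ (norm_nonneg _) (hR x (hanti (Nat.zero_le n) hx)) 2)
  have hlim : Tendsto d atTop (𝓝 (⨆ n, d n)) := tendsto_atTop_ciSup hmono hbdd
  set D := ⨆ n, d n
  have hex : ∀ n, ∃ x ∈ C n, ‖x‖ ^ 2 < d n + 1 / ((n : ℝ) + 1) := by
    intro n
    obtain ⟨_, ⟨x, hx, rfl⟩, hlt⟩ := exists_lt_of_csInf_lt (hSne n)
      (show sInf (S n) < d n + 1 / ((n : ℝ) + 1) from lt_add_of_pos_right _ (by positivity))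
    exact ⟨x, hx, hlt⟩
  choose x hxC hx using hex
  refine ⟨x, hxC, cauchySeq_tendsto_of_complete ?_⟩
  refine cauchySeq_of_le_tendsto_0
    (fun n : ℕ => Real.sqrt (4 * (D - d n) + 4 * (1 / ((n : ℝ) + 1)))) ?_ ?_
  · intro n m k hkn hkm
    apply Real.le_sqrt_of_sq_le
    have hest : ∀ j, k ≤ j → ‖x j‖ ^ 2 ≤ D + 1 / ((k : ℝ) + 1) := by
      intro j hj
      have h1 : d j ≤ D := le_ciSup hbdd j
      have h2 : 1 / ((j : ℝ) + 1) ≤ 1 / ((k : ℝ) + 1) := by gcongr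
      linarith [hx j]
    have hm := hd_le k _ (hmid k _ (hanti hkn (hxC n)) _ (hanti hkm (hxC m)))
    rw [norm_smul, mul_pow] at hm
    have hp := parallelogram_law_with_norm ℝ (x n) (x m)
    rw [dist_eq_norm]
    norm_num at hm
    have := hest n hkn
    have := hest m hkm
    norm_num at *
    nlinarith
  · have h1 : Tendsto (fun n : ℕ => 4 * (D - d n) + 4 * (1 / ((n : ℝ) + 1))) atTop
        (𝓝 (4 * (D - D) + 4 * 0)) :=
      ((tendsto_const_nhds.sub hlim).const_mul 4).add
        (tendsto_one_div_add_atTop_nhds_zero_nat.const_mul 4)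
    have h2 := h1.sqrt
    simpa using h2

section Clearing

variable {N : ℕ} {ℓ : Fin N → Fin N → ℝ} {a a' p q : Fin N → ℝ}

theorem lbar_nonneg (hℓ : ∀ i j, 0 ≤ ℓ i j) (i : Fin N) : 0 ≤ lbar ℓ i :=
  Finset.sum_nonneg fun j _ => hℓ i j

theorem relPi_nonneg (hℓ : ∀ i j, 0 ≤ ℓ i j) (i j : Fin N) : 0 ≤ relPi ℓ i j := by
  unfold relPi
  split_ifs with h
  · exact div_nonneg (hℓ i j) h.le
  · exact le_rfl

theorem sum_relPi_mul_le (hℓ : ∀ i j, 0 ≤ ℓ i j) (h : ∀ i, p i ≤ q i) (i : Fin N) :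
    ∑ j, relPi ℓ j i * p j ≤ ∑ j, relPi ℓ j i * q j :=
  Finset.sum_le_sum fun j _ => mul_le_mul_of_nonneg_left (h j) (relPi_nonneg hℓ j i)

theorem sum_relPi_mul_nonneg (hℓ : ∀ i j, 0 ≤ ℓ i j) (h : ∀ i, 0 ≤ p i) (i : Fin N) :
    0 ≤ ∑ j, relPi ℓ j i * p j :=
  Finset.sum_nonneg fun j _ => mul_nonneg (relPi_nonneg hℓ j i) (h j)

theorem Phi_mono (hℓ : ∀ i j, 0 ≤ ℓ i j) (h : ∀ i, p i ≤ q i) (i : Fin N) :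
    Phi (relPi ℓ) a (lbar ℓ) p i ≤ Phi (relPi ℓ) a (lbar ℓ) q i :=
  min_le_min (add_le_add (sum_relPi_mul_le hℓ h i) le_rfl) le_rfl

/-- Comparison principle: subsolutions of the clearing equation lie below nonnegative
supersolutions. -/
theorem le_of_le_Phi_of_Phi_le (hℓ : ∀ i j, 0 ≤ ℓ i j) (ha : ∀ i, 0 < a i)
    (hp0 : ∀ i, 0 ≤ p i) (hq : ∀ i, q i ≤ Phi (relPi ℓ) a (lbar ℓ) q i)
    (hp : ∀ i, Phi (relPi ℓ) a (lbar ℓ) p i ≤ p i) (i : Fin N) : q i ≤ p i := by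
  by_contra! hlt
  have hpos : ∀ k, 0 < lbar ℓ k → 0 < p k := fun k hk =>
    (lt_min (add_pos_of_nonneg_of_pos (sum_relPi_mul_nonneg hℓ hp0 k) (ha k)) hk).trans_le (hp k)
  have hql : ∀ k, q k ≤ lbar ℓ k := fun k => (hq k).trans (min_le_right _ _)
  have hi : 0 < lbar ℓ i := (hp0 i).trans_lt (hlt.trans_le (hql i))
  obtain ⟨m, hm, hmax⟩ := (Finset.univ.filter fun k => 0 < lbar ℓ k).exists_max_image
    (fun k => q k / p k) ⟨i, by simpa using hi⟩
  simp only [Finset.mem_filter, Finset.mem_univ, true_and] at hm hmax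
  set s := q m / p m with hs
  have hs1 : 1 < s := ((one_lt_div (hpos i hi)).2 hlt).trans_le (hmax i hi)
  have hqs : ∀ k, q k ≤ s * p k := by
    intro k
    rcases (lbar_nonneg hℓ k).eq_or_lt with h0 | h0
    · exact ((hql k).trans h0.symm.le).trans (mul_nonneg (by linarith) (hp0 k))
    · exact (div_le_iff₀ (hpos k h0)).1 (hmax k h0)
  have hqm : q m = s * p m := by rw [hs, div_mul_cancel₀ _ (hpos m hm).ne']
  have h1 : q m ≤ min (s * (∑ j, relPi ℓ j m * p j) + a m) (lbar ℓ m) := by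
    refine (hq m).trans (min_le_min (add_le_add ?_ le_rfl) le_rfl)
    refine (sum_relPi_mul_le hℓ hqs m).trans_eq ?_
    rw [Finset.mul_sum]
    exact Finset.sum_congr rfl fun j _ => by ring
  have h2 : min (s * (∑ j, relPi ℓ j m * p j) + a m) (lbar ℓ m)
      < s * Phi (relPi ℓ) a (lbar ℓ) p m := by
    unfold Phi
    rw [mul_min_of_nonneg _ _ (by linarith : (0 : ℝ) ≤ s), mul_add]
    exact min_lt_min (by nlinarith [ha m]) (by nlinarith)
  have h3 := mul_le_mul_of_nonneg_left (hp m) (by linarith : (0 : ℝ) ≤ s)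
  linarith

theorem Phi_continuous (π : Fin N → Fin N → ℝ) (a lb : Fin N → ℝ) : Continuous (Phi π a lb) := by
  unfold Phi; fun_prop

theorem Phi_iterate_spec (hℓ : ∀ i j, 0 ≤ ℓ i j) (ha : ∀ i, 0 < a i) (k : ℕ) :
    (∀ i, 0 ≤ (Phi (relPi ℓ) a (lbar ℓ))^[k] (lbar ℓ) i) ∧
    ∀ i, (Phi (relPi ℓ) a (lbar ℓ))^[k + 1] (lbar ℓ) i
      ≤ (Phi (relPi ℓ) a (lbar ℓ))^[k] (lbar ℓ) i := by
  induction k with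
  | zero => exact ⟨lbar_nonneg hℓ, fun i => min_le_right _ _⟩
  | succ k ih =>
    refine ⟨fun i => ?_, fun i => ?_⟩
    · rw [Function.iterate_succ_apply']
      exact le_min (add_nonneg (sum_relPi_mul_nonneg hℓ ih.1 i) (ha i).le) (lbar_nonneg hℓ i)
    · rw [Function.iterate_succ_apply' _ (k + 1)]
      conv_rhs => rw [Function.iterate_succ_apply']
      exact Phi_mono hℓ ih.2 i

theorem exists_tendsto_Phi_iterate (hℓ : ∀ i j, 0 ≤ ℓ i j) (ha : ∀ i, 0 < a i) :
    ∃ p : Fin N → ℝ, ((∀ i, 0 ≤ p i) ∧ Phi (relPi ℓ) a (lbar ℓ) p = p) ∧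
      Tendsto (fun k => (Phi (relPi ℓ) a (lbar ℓ))^[k] (lbar ℓ)) atTop (𝓝 p) := by
  set F := Phi (relPi ℓ) a (lbar ℓ) with hF
  have hlim : Tendsto (fun k => F^[k] (lbar ℓ)) atTop
      (𝓝 fun i => ⨅ k, F^[k] (lbar ℓ) i) := by
    refine tendsto_pi_nhds.2 fun i => tendsto_atTop_ciInf
      (antitone_nat_of_succ_le fun k => (Phi_iterate_spec hℓ ha k).2 i) ⟨0, ?_⟩
    rintro _ ⟨k, rfl⟩
    exact (Phi_iterate_spec hℓ ha k).1 i
  refine ⟨_, ⟨fun i => le_ciInf fun k => (Phi_iterate_spec hℓ ha k).1 i, ?_⟩, hlim⟩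
  have h1 := ((Phi_continuous (relPi ℓ) a (lbar ℓ)).tendsto _).comp hlim
  have h2 := hlim.comp (tendsto_add_atTop_nat 1)
  refine tendsto_nhds_unique h1 (h2.congr fun k => ?_)
  simp only [Function.comp_apply, Function.iterate_succ_apply', hF]

theorem clearingVec_spec (hℓ : ∀ i j, 0 ≤ ℓ i j) (ha : ∀ i, 0 < a i) :
    (∀ i, 0 ≤ clearingVec a ℓ i) ∧
      Phi (relPi ℓ) a (lbar ℓ) (clearingVec a ℓ) = clearingVec a ℓ :=
  Classical.epsilon_spec (p := fun p => (∀ i, 0 ≤ p i) ∧ Phi (relPi ℓ) a (lbar ℓ) p = p)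
    ((exists_tendsto_Phi_iterate hℓ ha).imp fun _ h => h.1)

theorem le_clearingVec (hℓ : ∀ i j, 0 ≤ ℓ i j) (ha : ∀ i, 0 < a i)
    (hq : ∀ i, q i ≤ Phi (relPi ℓ) a (lbar ℓ) q i) (i : Fin N) : q i ≤ clearingVec a ℓ i :=
  le_of_le_Phi_of_Phi_le hℓ ha (clearingVec_spec hℓ ha).1 hq
    (fun k => (congrFun (clearingVec_spec hℓ ha).2 k).le) i

theorem eq_clearingVec (hℓ : ∀ i j, 0 ≤ ℓ i j) (ha : ∀ i, 0 < a i) (hp0 : ∀ i, 0 ≤ p i)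
    (hp : Phi (relPi ℓ) a (lbar ℓ) p = p) : p = clearingVec a ℓ := by
  funext i
  refine le_antisymm (le_clearingVec hℓ ha (fun k => (congrFun hp k).ge) i) ?_
  exact le_of_le_Phi_of_Phi_le hℓ ha hp0 (fun k => (congrFun (clearingVec_spec hℓ ha).2 k).ge)
    (fun k => (congrFun hp k).le) i

theorem tendsto_Phi_iterate (hℓ : ∀ i j, 0 ≤ ℓ i j) (ha : ∀ i, 0 < a i) :
    Tendsto (fun k => (Phi (relPi ℓ) a (lbar ℓ))^[k] (lbar ℓ)) atTop (𝓝 (clearingVec a ℓ)) := by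
  obtain ⟨p, ⟨h0, hp⟩, hlim⟩ := exists_tendsto_Phi_iterate hℓ ha
  rwa [← eq_clearingVec hℓ ha h0 hp]

theorem clearingVec_le_lbar (hℓ : ∀ i j, 0 ≤ ℓ i j) (ha : ∀ i, 0 < a i) (i : Fin N) :
    clearingVec a ℓ i ≤ lbar ℓ i := by
  rw [← (clearingVec_spec hℓ ha).2]
  exact min_le_right _ _

theorem smul_clearingVec_le (hℓ : ∀ i j, 0 ≤ ℓ i j) (ha : ∀ i, 0 < a i) (ha' : ∀ i, 0 < a' i)
    {r : ℝ} (hr0 : 0 ≤ r) (hr1 : r ≤ 1) (h : ∀ i, r * a i ≤ a' i) (i : Fin N) :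
    r * clearingVec a ℓ i ≤ clearingVec a' ℓ i := by
  refine le_clearingVec hℓ ha' (q := fun k => r * clearingVec a ℓ k) (fun k => ?_) i
  conv_lhs => rw [← (clearingVec_spec hℓ ha).2]
  unfold Phi
  rw [mul_min_of_nonneg _ _ hr0, mul_add, Finset.mul_sum]
  refine min_le_min (add_le_add (le_of_eq ?_) (h k)) ?_
  · exact Finset.sum_congr rfl fun j _ => by ring
  · exact mul_le_of_le_one_left (lbar_nonneg hℓ k) hr1

theorem clearingVec_midpoint (hℓ : ∀ i j, 0 ≤ ℓ i j) (ha : ∀ i, 0 < a i) (ha' : ∀ i, 0 < a' i)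
    (i : Fin N) : 1 / 2 * clearingVec a ℓ i + 1 / 2 * clearingVec a' ℓ i
      ≤ clearingVec (fun k => 1 / 2 * a k + 1 / 2 * a' k) ℓ i := by
  refine le_clearingVec hℓ (fun k => by linarith [ha k, ha' k])
    (q := fun k => 1 / 2 * clearingVec a ℓ k + 1 / 2 * clearingVec a' ℓ k) (fun k => ?_) i
  have h1 := congrFun (clearingVec_spec hℓ ha).2 k
  have h2 := congrFun (clearingVec_spec hℓ ha').2 k
  unfold Phi at *
  have h3 := h1.ge.trans (min_le_left _ _)
  have h4 := h2.ge.trans (min_le_left _ _)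
  have h5 := h1.ge.trans (min_le_right _ _)
  have h6 := h2.ge.trans (min_le_right _ _)
  refine le_min ?_ (by linarith)
  have : ∑ j, relPi ℓ j k * (1 / 2 * clearingVec a ℓ j + 1 / 2 * clearingVec a' ℓ j)
      = 1 / 2 * ∑ j, relPi ℓ j k * clearingVec a ℓ j
        + 1 / 2 * ∑ j, relPi ℓ j k * clearingVec a' ℓ j := by
    rw [Finset.mul_sum, Finset.mul_sum, ← Finset.sum_add_distrib]
    exact Finset.sum_congr rfl fun j _ => by ring
  rw [this]
  linarith

theorem tendsto_clearingVec (hℓ : ∀ i j, 0 ≤ ℓ i j) (ha : ∀ i, 0 < a i) {u : ℕ → Fin N → ℝ}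
    (hu0 : ∀ n i, 0 < u n i) (hu : Tendsto u atTop (𝓝 a)) (i : Fin N) :
    Tendsto (fun n => clearingVec (u n) ℓ i) atTop (𝓝 (clearingVec a ℓ i)) := by
  have hcv0 := (clearingVec_spec hℓ ha).1 i
  have hkey : ∀ r : ℝ, 0 < r → r < 1 → ∀ᶠ n in atTop, r * clearingVec a ℓ i ≤ clearingVec (u n) ℓ i
      ∧ r * clearingVec (u n) ℓ i ≤ clearingVec a ℓ i := by
    intro r hr0 hr1
    have h : ∀ k, ∀ᶠ n in atTop, r * a k ≤ u n k ∧ r * u n k ≤ a k := by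
      intro k
      have hk : Tendsto (fun n => u n k) atTop (𝓝 (a k)) := tendsto_pi_nhds.1 hu k
      have hlt : r * a k < a k := by nlinarith [ha k]
      filter_upwards [hk.eventually_const_lt hlt, (hk.const_mul r).eventually_lt_const hlt]
        with n h1 h2 using ⟨h1.le, h2.le⟩
    filter_upwards [eventually_all.2 h] with n hn
    exact ⟨smul_clearingVec_le hℓ ha (hu0 n) hr0.le hr1.le (fun k => (hn k).1) i,
      smul_clearingVec_le hℓ (hu0 n) ha hr0.le hr1.le (fun k => (hn k).2) i⟩
  set c := clearingVec a ℓ i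
  have hr : Tendsto (fun r : ℝ => r * c) (𝓝[<] 1) (𝓝 c) := by
    have : ContinuousAt (fun r : ℝ => r * c) 1 := by fun_prop
    simpa using this.tendsto.mono_left nhdsWithin_le_nhds
  have hr' : Tendsto (fun r : ℝ => c / r) (𝓝[<] 1) (𝓝 c) := by
    have : ContinuousAt (fun r : ℝ => c / r) 1 := by fun_prop (disch := norm_num)
    simpa using this.tendsto.mono_left nhdsWithin_le_nhds
  have hmem : ∀ᶠ r : ℝ in 𝓝[<] 1, 0 < r ∧ r < 1 :=
    Ioo_mem_nhdsLT (show (0 : ℝ) < 1 by norm_num)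
  refine tendsto_order.2 ⟨fun x hx => ?_, fun x hx => ?_⟩
  · obtain ⟨r, ⟨h0, h1⟩, h2⟩ := (hmem.and (hr.eventually_const_lt hx)).exists
    filter_upwards [hkey r h0 h1] with n hn using h2.trans_le hn.1
  · obtain ⟨r, ⟨h0, h1⟩, h2⟩ := (hmem.and (hr'.eventually_lt_const hx)).exists
    filter_upwards [hkey r h0 h1] with n hn
    exact ((le_div_iff₀' h0).2 hn.2).trans_lt h2

theorem aggLoss_nonneg (hℓ : ∀ i j, 0 ≤ ℓ i j) (ha : ∀ i, 0 < a i) : 0 ≤ aggLoss a ℓ :=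
  Finset.sum_nonneg fun i _ => sub_nonneg.2 (clearingVec_le_lbar hℓ ha i)

theorem aggLoss_le (hℓ : ∀ i j, 0 ≤ ℓ i j) (ha : ∀ i, 0 < a i) :
    aggLoss a ℓ ≤ ∑ i, ∑ j, ℓ i j :=
  Finset.sum_le_sum fun i _ => sub_le_self _ ((clearingVec_spec hℓ ha).1 i)

theorem aggLoss_midpoint (hℓ : ∀ i j, 0 ≤ ℓ i j) (ha : ∀ i, 0 < a i) (ha' : ∀ i, 0 < a' i) :
    aggLoss (fun k => 1 / 2 * a k + 1 / 2 * a' k) ℓ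
      ≤ 1 / 2 * aggLoss a ℓ + (1 - 1 / 2) * aggLoss a' ℓ := by
  unfold aggLoss
  rw [Finset.mul_sum, Finset.mul_sum, ← Finset.sum_add_distrib]
  exact Finset.sum_le_sum fun i _ => by linarith [clearingVec_midpoint hℓ ha ha' i]

theorem tendsto_aggLoss (hℓ : ∀ i j, 0 ≤ ℓ i j) (ha : ∀ i, 0 < a i) {u : ℕ → Fin N → ℝ}
    (hu0 : ∀ n i, 0 < u n i) (hu : Tendsto u atTop (𝓝 a)) :
    Tendsto (fun n => aggLoss (u n) ℓ) atTop (𝓝 (aggLoss a ℓ)) :=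
  tendsto_finsetSum _ fun i _ => tendsto_const_nhds.sub (tendsto_clearingVec hℓ ha hu0 hu i)

theorem aggLoss_eq_zero (hℓ : ∀ i j, 0 ≤ ℓ i j) (ha : ∀ i, 0 < a i)
    (h : ∀ i, lbar ℓ i ≤ a i) : aggLoss a ℓ = 0 := by
  refine Finset.sum_eq_zero fun i _ => sub_eq_zero.2 (congrFun (eq_clearingVec hℓ ha
    (lbar_nonneg hℓ) (funext fun k => min_eq_right ?_)) i)
  linarith [h k, sum_relPi_mul_nonneg hℓ (lbar_nonneg hℓ) k]

end Clearing

section Random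

variable {Ω : Type*} [MeasurableSpace Ω] {N : ℕ} {A : Ω → Fin N → ℝ} {L : Ω → Fin N → Fin N → ℝ}

theorem measurable_Phi_iterate (hA : Measurable A) (hL : Measurable L) (k : ℕ) :
    Measurable fun ω => (Phi (relPi (L ω)) (A ω) (lbar (L ω)))^[k] (lbar (L ω)) := by
  have hLi : ∀ i j, Measurable fun ω => L ω i j := fun i j =>
    (measurable_pi_apply j).comp ((measurable_pi_apply i).comp hL)
  have hlb : ∀ i, Measurable fun ω => lbar (L ω) i := fun i =>
    Finset.measurable_sum _ fun j _ => hLi i j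
  have hπ : ∀ i j, Measurable fun ω => relPi (L ω) i j := fun i j =>
    Measurable.ite (measurableSet_lt measurable_const (hlb i)) ((hLi i j).div (hlb i))
      measurable_const
  induction k with
  | zero => exact measurable_pi_lambda _ hlb
  | succ k ih =>
    simp only [Function.iterate_succ_apply']
    refine measurable_pi_lambda _ fun i => Measurable.min (Measurable.add ?_ ?_) (hlb i)
    · exact Finset.measurable_sum _ fun j _ => (hπ j i).mul ((measurable_pi_apply j).comp ih)
    · exact (measurable_pi_apply i).comp hA

theorem measurable_aggLoss (hA : Measurable A) (hApos : ∀ ω i, 0 < A ω i) (hL : Measurable L)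
    (hLnn : ∀ ω i j, 0 ≤ L ω i j) : Measurable fun ω => aggLoss (A ω) (L ω) := by
  have hcv : Measurable fun ω => clearingVec (A ω) (L ω) :=
    measurable_of_tendsto_metrizable (measurable_Phi_iterate hA hL)
      (tendsto_pi_nhds.2 fun ω => tendsto_Phi_iterate (hLnn ω) (hApos ω))
  refine Finset.measurable_sum _ fun i _ => Measurable.sub ?_ ((measurable_pi_apply i).comp hcv)
  exact Finset.measurable_sum _ fun j _ =>
    (measurable_pi_apply j).comp ((measurable_pi_apply i).comp hL)

theorem integrable_aggLoss {P : Measure Ω} (hA : Measurable A) (hApos : ∀ ω i, 0 < A ω i)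
    (hL : Measurable L) (hLnn : ∀ ω i j, 0 ≤ L ω i j)
    (hLint : Integrable (fun ω => ∑ i, ∑ j, L ω i j) P) :
    Integrable (fun ω => aggLoss (A ω) (L ω)) P :=
  hLint.mono' (measurable_aggLoss hA hApos hL hLnn).aestronglyMeasurable <|
    .of_forall fun ω => by
      rw [Real.norm_of_nonneg (aggLoss_nonneg (hLnn ω) (hApos ω))]
      exact aggLoss_le (hLnn ω) (hApos ω)

/-- An `L¹`-continuous functional is continuous along dominated a.e. convergent sequences. -/
theorem tendsto_of_dominated {P : Measure Ω} {η : (Ω → ℝ) → ℝ}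
    (hη : ∀ ε : ℝ, 0 < ε → ∃ δ : ℝ, 0 < δ ∧ ∀ X Y : Ω → ℝ,
      Integrable X P → Integrable Y P → (∫ ω, |X ω - Y ω| ∂P) < δ → |η X - η Y| < ε)
    {X : ℕ → Ω → ℝ} {Z G : Ω → ℝ} (hX : ∀ n, Integrable (X n) P) (hZ : Integrable Z P)
    (hG : Integrable G P) (hXG : ∀ n ω, |X n ω| ≤ G ω)
    (hlim : ∀ᵐ ω ∂P, Tendsto (fun n => X n ω) atTop (𝓝 (Z ω))) :
    Tendsto (fun n => η (X n)) atTop (𝓝 (η Z)) := by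
  have h : Tendsto (fun n => ∫ ω, |X n ω - Z ω| ∂P) atTop (𝓝 (∫ _, (0 : ℝ) ∂P)) := by
    refine tendsto_integral_of_dominated_convergence (fun ω => G ω + |Z ω|)
      (fun n => ((hX n).sub hZ).abs.aestronglyMeasurable) (hG.add hZ.abs) (fun n => ?_) ?_
    · refine .of_forall fun ω => ?_
      rw [Real.norm_eq_abs, abs_abs]
      exact (abs_sub _ _).trans (add_le_add (hXG n ω) le_rfl)
    · filter_upwards [hlim] with ω hω
      simpa using (hω.sub_const (Z ω)).abs
  rw [integral_zero] at h
  refine Metric.tendsto_atTop'.2 fun ε hε => ?_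
  obtain ⟨δ, hδ, hη⟩ := hη ε hε
  obtain ⟨n₀, hn₀⟩ := eventually_atTop.1 (h.eventually_lt_const hδ)
  exact ⟨n₀, fun n hn => hη _ _ (hX n) hZ (hn₀ n hn.le)⟩

end Random

theorem EuclideanSpace.norm_le_sum_of_nonneg {ι : Type*} [Fintype ι] (x : EuclideanSpace ℝ ι)
    (hx : ∀ i, 0 ≤ x i) : ‖x‖ ≤ ∑ i, x i := by
  rw [EuclideanSpace.norm_eq]
  refine Real.sqrt_le_iff.2 ⟨Finset.sum_nonneg fun i _ => hx i, ?_⟩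
  simp only [Real.norm_eq_abs, sq_abs]
  exact Finset.sum_sq_le_sq_sum_of_nonneg fun i _ => hx i

/-- The infimum defining the systemic risk measure is attained: there is an
admissible allocation `Y*` whose components sum a.s. to `ρ_b(A, L)` and which makes the
system acceptable. -/
theorem sysRisk_attained
    {Ω : Type*} [MeasurableSpace Ω] (P : Measure Ω) [IsProbabilityMeasure P]
    (N : ℕ) (hN : 1 ≤ N)
    (η : (Ω → ℝ) → ℝ)
    (hη_mono : ∀ X Y : Ω → ℝ, Integrable X P → Integrable Y P →
      (∀ᵐ ω ∂P, X ω ≤ Y ω) → η X ≤ η Y)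
    (hη_conv : ∀ X Y : Ω → ℝ, Integrable X P → Integrable Y P → ∀ t : ℝ, 0 ≤ t → t ≤ 1 →
      η (fun ω => t * X ω + (1 - t) * Y ω) ≤ t * η X + (1 - t) * η Y)
    (hη_norm : η (fun _ => 0) = 0)
    (hη_cont : ∀ ε : ℝ, 0 < ε → ∃ δ : ℝ, 0 < δ ∧ ∀ X Y : Ω → ℝ,
      Integrable X P → Integrable Y P → (∫ ω, |X ω - Y ω| ∂P) < δ → |η X - η Y| < ε)
    (A : Ω → Fin N → ℝ) (hA : Measurable A) (hApos : ∀ ω i, 0 < A ω i)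
    (L : Ω → Fin N → Fin N → ℝ) (hL : Measurable L)
    (hLnn : ∀ ω i j, 0 ≤ L ω i j) (hLdiag : ∀ ω i, L ω i i = 0)
    (hLint : Integrable (fun ω => ∑ i, ∑ j, L ω i j) P)
    (b : ℝ) (hb : 0 < b)
    :
    ∃ Y : Ω → Fin N → ℝ, Measurable Y ∧ (∀ ω i, 0 ≤ Y ω i) ∧
      (∀ᵐ ω ∂P, ∑ i, Y ω i = sysRisk P η A L b) ∧
      η (fun ω => aggLoss (fun i => A ω i + Y ω i) (L ω)) ≤ b := by
  have hApos' : ∀ Y : Ω → Fin N → ℝ, (∀ ω i, 0 ≤ Y ω i) → ∀ ω i, 0 < A ω i + Y ω i :=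
    fun Y hY ω i => add_pos_of_pos_of_nonneg (hApos ω i) (hY ω i)
  have h_int : ∀ Y : Ω → Fin N → ℝ, Measurable Y → (∀ ω i, 0 ≤ Y ω i) →
      Integrable (fun ω => aggLoss (fun i => A ω i + Y ω i) (L ω)) P := fun Y hYm hY =>
    integrable_aggLoss (hA.add hYm) (hApos' Y hY) hL hLnn hLint
  have hbound : ∀ Y : Ω → Fin N → ℝ, (∀ ω i, 0 ≤ Y ω i) → ∀ ω,
      |aggLoss (fun i => A ω i + Y ω i) (L ω)| ≤ ∑ i, ∑ j, L ω i j := fun Y hY ω => by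
    rw [abs_of_nonneg (aggLoss_nonneg (hLnn ω) (hApos' Y hY ω))]
    exact aggLoss_le (hLnn ω) (hApos' Y hY ω)
  have hne : (feas P η A L b).Nonempty := by
    have h : Tendsto (fun n : ℕ => η fun ω => aggLoss (fun i => A ω i + (n : ℝ)) (L ω)) atTop
        (𝓝 (η fun _ => 0)) := by
      refine tendsto_of_dominated hη_cont
        (fun n => h_int (fun _ _ => n) measurable_const fun _ _ => n.cast_nonneg)
        (integrable_zero _ _ _) hLint
        (fun n => hbound (fun _ _ => n) fun _ _ => n.cast_nonneg) (.of_forall fun ω => ?_)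
      refine tendsto_const_nhds.congr' ?_
      filter_upwards [eventually_all.2 fun i =>
        tendsto_natCast_atTop_atTop.eventually_ge_atTop (lbar (L ω) i)] with n hn
      refine (aggLoss_eq_zero (hLnn ω) (fun i => ?_) fun i => ?_).symm
      · exact add_pos_of_pos_of_nonneg (hApos ω i) n.cast_nonneg
      · linarith [hn i, hApos ω i]
    rw [hη_norm] at h
    obtain ⟨n, hn⟩ := (h.eventually_lt_const hb).exists
    exact ⟨∑ _i : Fin N, (n : ℝ), fun _ _ => n, measurable_const, fun _ _ => n.cast_nonneg,
      .of_forall fun _ => rfl, hn.le⟩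
  have hfeas0 : ∀ c ∈ feas P η A L b, 0 ≤ c := by
    rintro c ⟨Y, -, hY, hc, -⟩
    obtain ⟨ω, hω⟩ := hc.exists
    exact hω ▸ Finset.sum_nonneg fun i _ => hY ω i
  set ρ := sysRisk P η A L b
  have hρ_le : ∀ c ∈ feas P η A L b, ρ ≤ c := fun c hc => csInf_le ⟨0, hfeas0⟩ hc
  let C : ℕ → Set (Lp (EuclideanSpace ℝ (Fin N)) 2 P) := fun n =>
    {f | ∃ (Y : Ω → Fin N → ℝ) (c : ℝ), c ≤ ρ + 1 / ((n : ℝ) + 1) ∧ Measurable Y ∧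
      (∀ ω i, 0 ≤ Y ω i) ∧ (∀ᵐ ω ∂P, ∑ i, Y ω i = c) ∧
      η (fun ω => aggLoss (fun i => A ω i + Y ω i) (L ω)) ≤ b ∧ ∀ᵐ ω ∂P, ∀ i, f ω i = Y ω i}
  have hCanti : Antitone C := by
    rintro m n hmn f ⟨Y, c, hc, h⟩
    exact ⟨Y, c, hc.trans (by gcongr), h⟩
  have hCne : ∀ n, (C n).Nonempty := by
    intro n
    obtain ⟨c, ⟨Y, hYm, hY, hYc, hYb⟩, hc⟩ := exists_lt_of_csInf_lt hne
      (show sInf (feas P η A L b) < ρ + 1 / ((n : ℝ) + 1) from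
        lt_add_of_pos_right _ (by positivity))
    have hmem : MemLp (fun ω => WithLp.toLp 2 (Y ω) : Ω → EuclideanSpace ℝ (Fin N)) 2 P := by
      refine MemLp.of_bound (by fun_prop) c ?_
      filter_upwards [hYc] with ω hω
      exact hω ▸ EuclideanSpace.norm_le_sum_of_nonneg _ (hY ω)
    refine ⟨hmem.toLp, Y, c, hc.le, hYm, hY, hYc, hYb, ?_⟩
    filter_upwards [hmem.coeFn_toLp] with ω hω i
    rw [hω]
  have hCmid : ∀ n, ∀ f ∈ C n, ∀ g ∈ C n, (1 / 2 : ℝ) • (f + g) ∈ C n := by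
    rintro n f ⟨Y, c, hc, hYm, hY, hYc, hYb, hfY⟩ g ⟨Z, e, he, hZm, hZ, hZe, hZb, hgZ⟩
    have hWm : Measurable fun ω i => 1 / 2 * Y ω i + 1 / 2 * Z ω i := by fun_prop
    have hW : ∀ ω i, 0 ≤ 1 / 2 * Y ω i + 1 / 2 * Z ω i := fun ω i => by
      linarith [hY ω i, hZ ω i]
    refine ⟨fun ω i => 1 / 2 * Y ω i + 1 / 2 * Z ω i, 1 / 2 * c + 1 / 2 * e, by linarith, hWm, hW,
      ?_, ?_, ?_⟩
    · filter_upwards [hYc, hZe] with ω h1 h2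
      rw [Finset.sum_add_distrib, ← Finset.mul_sum, ← Finset.mul_sum, h1, h2]
    · have hIY := h_int Y hYm hY
      have hIZ := h_int Z hZm hZ
      refine (hη_mono _ _ (h_int _ hWm hW)
        ((hIY.const_mul (1 / 2)).add (hIZ.const_mul (1 - 1 / 2))) (.of_forall fun ω => ?_)).trans
        ((hη_conv _ _ hIY hIZ (1 / 2) (by norm_num) (by norm_num)).trans (by linarith))
      refine Eq.trans_le ?_ (aggLoss_midpoint (hLnn ω) (hApos' Y hY ω) (hApos' Z hZ ω))
      congr 1
      funext i
      ring
    · filter_upwards [hfY, hgZ, Lp.coeFn_smul (1 / 2 : ℝ) (f + g), Lp.coeFn_add f g]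
        with ω h1 h2 h3 h4 i
      rw [h3, Pi.smul_apply, h4, Pi.add_apply, PiLp.smul_apply, PiLp.add_apply, h1, h2,
        smul_eq_mul, mul_add]
  have hCbdd : ∃ R : ℝ, ∀ f ∈ C 0, ‖f‖ ≤ R := by
    have hρ0 : 0 ≤ ρ + 1 := add_nonneg (le_csInf hne hfeas0) zero_le_one
    refine ⟨_, fun f hf => Lp.norm_le_of_ae_bound hρ0 ?_⟩
    obtain ⟨Y, c, hc, -, hY, hYc, -, hfY⟩ := hf
    filter_upwards [hYc, hfY] with ω h1 h2
    refine (EuclideanSpace.norm_le_sum_of_nonneg _ fun i => (h2 i).symm ▸ hY ω i).trans ?_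
    rw [Finset.sum_congr rfl fun i _ => h2 i, h1]
    simpa using hc
  obtain ⟨R, hR⟩ := hCbdd
  obtain ⟨x, hxC, l, hxl⟩ :=
    exists_seq_mem_tendsto_of_antitone_midpoint C hCanti hCne hCmid R hR
  choose Y c hc hYm hY hYc hYb hxY using hxC
  have hcρ : Tendsto c atTop (𝓝 ρ) := by
    refine tendsto_of_tendsto_of_tendsto_of_le_of_le tendsto_const_nhds
      (h := fun n : ℕ => ρ + 1 / ((n : ℝ) + 1)) ?_
      (fun n => hρ_le _ ⟨Y n, hYm n, hY n, hYc n, hYb n⟩) hc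
    simpa using tendsto_one_div_add_atTop_nhds_zero_nat.const_add ρ
  obtain ⟨φ, hφ, hφl⟩ := (tendstoInMeasure_of_tendsto_Lp hxl).exists_seq_tendsto_ae
  have hlim : ∀ᵐ ω ∂P, ∀ i, Tendsto (fun n => Y (φ n) ω i) atTop (𝓝 (max (l ω i) 0)) := by
    filter_upwards [hφl, ae_all_iff.2 hxY] with ω h1 h2 i
    have h3 : Tendsto (fun n => Y (φ n) ω i) atTop (𝓝 (l ω i)) :=
      (((EuclideanSpace.proj (𝕜 := ℝ) i).continuous.tendsto _).comp h1).congr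
        fun n => h2 (φ n) i
    rwa [max_eq_left (ge_of_tendsto' h3 fun n => hY _ ω i)]
  have hlm : Measurable fun ω i => max (l ω i) 0 := by
    have := (Lp.stronglyMeasurable l).measurable
    fun_prop
  have hl0 : ∀ ω i, 0 ≤ max (l ω i) 0 := fun ω i => le_max_right _ _
  refine ⟨fun ω i => max (l ω i) 0, hlm, hl0, ?_, ?_⟩
  · filter_upwards [hlim, ae_all_iff.2 hYc] with ω h1 h2
    refine tendsto_nhds_unique (tendsto_finsetSum _ fun i _ => h1 i) ?_
    exact (hcρ.comp hφ.tendsto_atTop).congr fun n => (h2 (φ n)).symm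
  · refine le_of_tendsto' (tendsto_of_dominated hη_cont
      (fun n => h_int _ (hYm (φ n)) (hY (φ n))) (h_int _ hlm hl0) hLint
      (fun n => hbound _ (hY (φ n))) ?_) fun n => hYb (φ n)
    filter_upwards [hlim] with ω hω
    exact tendsto_aggLoss (hLnn ω) (hApos' _ hl0 ω) (fun n => hApos' _ (hY (φ n)) ω)
      (tendsto_pi_nhds.2 fun i => (hω i).const_add _)
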